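/- Suppose [·,·] is a Lie bracket on ℝ^7 and Λ : ℝ^7 → 𝔤𝔩(7,ℝ) is a linear map with Λ(x)y − Λ(y)x = [x,y] and Λ(x) ∈ 𝔥^III for all x,y ∈ ℝ^7. Write Λ(e_i) = h(A_i, v_i, (y_{i1},y_{i2})). If for r = 1 or r = 4 one has both 2(tr A_r)² + det(A_r) ≠ 0 and 6(tr A_r)² + det(A_r) ≠ 0, then the infinitesimal holonomy 𝔥 is decomposable. -/

import Mathlib

open Matrix

noncomputable section

abbrev V7 : Type := Fin 7 → ℝ
abbrev M7 : Type := Matrix (Fin 7) (Fin 7) ℝ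
abbrev M2 : Type := Matrix (Fin 2) (Fin 2) ℝ

/-- The standard basis of `ℝ^7` (0-indexed: `e 0` is `e_1` of the paper). -/
def e (i : Fin 7) : V7 := Pi.single i 1

/-- The symmetric bilinear form of signature (4,3):
`⟨e_1,e_5⟩ = ⟨e_2,e_6⟩ = ⟨e_3,e_7⟩ = 1`, `⟨e_4,e_4⟩ = −1`. -/
def ip (u v : V7) : ℝ :=
  u 0 * v 4 + u 4 * v 0 + u 1 * v 5 + u 5 * v 1 + u 2 * v 6 + u 6 * v 2 - u 3 * v 3

/-- The matrix `h(A,v,u,y)`. -/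
def hmat (A : M2) (v : ℝ) (u y : Fin 2 → ℝ) : M7 :=
  !![A 0 0 + A 1 1, -u 1, u 0, Real.sqrt 2 * v, 0, -y 0, -y 1;
     0, A 0 0, A 0 1, Real.sqrt 2 * u 0, y 0, 0, v;
     0, A 1 0, A 1 1, Real.sqrt 2 * u 1, y 1, -v, 0;
     0, 0, 0, 0, Real.sqrt 2 * v, Real.sqrt 2 * u 0, Real.sqrt 2 * u 1;
     0, 0, 0, 0, -(A 0 0 + A 1 1), 0, 0;
     0, 0, 0, 0, u 1, -A 0 0, -A 1 0;
     0, 0, 0, 0, -u 0, -A 0 1, -A 1 1]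

/-- `𝔥^I = {h(A,v,u,y)}`. -/
def hI : Set M7 := {X | ∃ A v u y, X = hmat A v u y}

/-- The matrix `h(A,v,y) := h(A,v,0,y)`. -/
def h3 (A : M2) (v : ℝ) (y : Fin 2 → ℝ) : M7 := hmat A v 0 y

/-- `𝔥^III = {h(A,v,y)}`. -/
def hIII : Set M7 := {X | ∃ A v y, X = h3 A v y}

/-- `𝔪(1,0,1) = {h(0,v,(y_1,0))}`. -/
def m101 : Set M7 := {X | ∃ v y1, X = h3 0 v ![y1, 0]}

/-- `𝔪(1,0,2) = {h(0,v,(y_1,y_2))}`. -/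
def m102 : Set M7 := {X | ∃ v y, X = h3 0 v y}

/-- The projection `pro_A` (reading off the relevant entries; on `𝔥^III` and `𝔥^I`
it gives the `𝔤𝔩(2,ℝ)`-component `A`). -/
def proA (X : M7) : M2 := !![X 1 1, X 1 2; X 2 1, X 2 2]

/-- The projection `pro_v` (on `𝔥^III` and `𝔥^I` it gives the component `v`). -/
def proV (X : M7) : ℝ := X 1 6

/-- The curvature `R(x,y) = Λ(x)Λ(y) − Λ(y)Λ(x) − Λ([x,y])`. -/
def curv (L : V7 →ₗ[ℝ] M7) (bk : V7 → V7 → V7) (x y : V7) : M7 :=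
  L x * L y - L y * L x - L (bk x y)

/-- The infinitesimal holonomy: the smallest linear subspace of `𝔤𝔩(7,ℝ)` containing
all `R(x,y)` and stable under bracketing with all `Λ(z)`. -/
def infHol (L : V7 →ₗ[ℝ] M7) (bk : V7 → V7 → V7) : Submodule ℝ M7 :=
  sInf {H : Submodule ℝ M7 | (∀ x y, curv L bk x y ∈ H) ∧
    ∀ z : V7, ∀ X ∈ H, L z * X - X * L z ∈ H}

/-- A set of matrices is decomposable if some nontrivial proper subspace `W` is invariant
and the restriction of `⟨·,·⟩` to `W` is nondegenerate. -/
def Decomposable (H : Set M7) : Prop :=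
  ∃ W : Submodule ℝ V7, W ≠ ⊥ ∧ W ≠ ⊤ ∧
    (∀ X ∈ H, ∀ w ∈ W, X.mulVec w ∈ W) ∧
    (∀ w ∈ W, (∀ w' ∈ W, ip w w' = 0) → w = 0)

section LinearAlgebra

lemma exists_of_mem_hIII {X : M7} (hX : X ∈ hIII) : ∃ a b c d v p q, X = h3 !![a, b; c, d] v ![p, q] := by
  obtain ⟨A, v, y, rfl⟩ := hX
  refine ⟨A 0 0, A 0 1, A 1 0, A 1 1, v, y 0, y 1, ?_⟩
  congr 1
  · exact Matrix.eta_fin_two A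
  · ext i; fin_cases i <;> rfl

lemma sub_mem_hIII {X Y : M7} (hX : X ∈ hIII) (hY : Y ∈ hIII) : X - Y ∈ hIII := by
  obtain ⟨A, v, y, rfl⟩ := hX
  obtain ⟨A', v', y', rfl⟩ := hY
  refine ⟨A - A', v - v', y - y', ?_⟩
  ext i j
  fin_cases i <;> fin_cases j <;> simp [h3, hmat] <;> ring

lemma h3_mulVec_e0 (a b c d v p q : ℝ) :
    h3 !![a, b; c, d] v ![p, q] *ᵥ e 0 = (a + d) • e 0 := by
  ext i; fin_cases i <;> simp [h3, hmat, e]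

lemma h3_mulVec_e1 (a b c d v p q : ℝ) :
    h3 !![a, b; c, d] v ![p, q] *ᵥ e 1 = a • e 1 + c • e 2 := by
  ext i; fin_cases i <;> simp [h3, hmat, e]

lemma h3_mulVec_e2 (a b c d v p q : ℝ) :
    h3 !![a, b; c, d] v ![p, q] *ᵥ e 2 = b • e 1 + d • e 2 := by
  ext i; fin_cases i <;> simp [h3, hmat, e]

lemma h3_mulVec_e3 (a b c d v p q : ℝ) :
    h3 !![a, b; c, d] v ![p, q] *ᵥ e 3 = (Real.sqrt 2 * v) • e 0 := by
  ext i; fin_cases i <;> simp [h3, hmat, e]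

lemma h3_mulVec_e4 (a b c d v p q : ℝ) :
    h3 !![a, b; c, d] v ![p, q] *ᵥ e 4 =
      p • e 1 + q • e 2 + (Real.sqrt 2 * v) • e 3 + (-(a + d)) • e 4 := by
  ext i; fin_cases i <;> simp [h3, hmat, e]

lemma h3_mulVec_e5 (a b c d v p q : ℝ) :
    h3 !![a, b; c, d] v ![p, q] *ᵥ e 5 =
    (-p) • e 0 + (-v) • e 2 + (-a) • e 5 + (-b) • e 6 := by
  ext i; fin_cases i <;> simp [h3, hmat, e]

lemma h3_mulVec_e6 (a b c d v p q : ℝ) :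
    h3 !![a, b; c, d] v ![p, q] *ᵥ e 6 =
    (-q) • e 0 + v • e 1 + (-c) • e 5 + (-d) • e 6 := by
  ext i; fin_cases i <;> simp [h3, hmat, e]

lemma h3_commutator (a b c d v p q a' b' c' d' v' p' q' : ℝ) :
    h3 !![a, b; c, d] v ![p, q] * h3 !![a', b'; c', d'] v' ![p', q'] -
      h3 !![a', b'; c', d'] v' ![p', q'] * h3 !![a, b; c, d] v ![p, q] =
      h3 !![b * c' - b' * c, a * b' + b * d' - (a' * b + b' * d);
          c * a' + d * c' - (c' * a + d' * c), -(b * c' - b' * c)]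
        ((a + d) * v' - (a' + d') * v)
        ![(2 * a + d) * p' + b * q' - ((2 * a' + d') * p + b' * q),
          c * p' + (a + 2 * d) * q' - (c' * p + (a' + 2 * d') * q)] := by
  apply Matrix.ext_of_mulVec_single
  intro i
  change _ *ᵥ e i = _ *ᵥ e i
  rw [Matrix.sub_mulVec, ← Matrix.mulVec_mulVec, ← Matrix.mulVec_mulVec]
  fin_cases i <;>
    simp only [Fin.reduceFinMk, Fin.mk_one, Fin.zero_eta, h3_mulVec_e0, h3_mulVec_e1,
      h3_mulVec_e2, h3_mulVec_e3, h3_mulVec_e4, h3_mulVec_e5, h3_mulVec_e6, Matrix.mulVec_add,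
      Matrix.mulVec_smul] <;>
    module

lemma commutator_mem_hIII {X Y : M7} (hX : X ∈ hIII) (hY : Y ∈ hIII) :
    X * Y - Y * X ∈ hIII := by
  obtain ⟨a, b, c, d, v, p, q, rfl⟩ := exists_of_mem_hIII hX
  obtain ⟨a', b', c', d', v', p', q', rfl⟩ := exists_of_mem_hIII hY
  exact ⟨_, _, _, h3_commutator ..⟩

end LinearAlgebra

section Form

lemma ip_add_left (x y z : V7) : ip (x + y) z = ip x z + ip y z := by
  simp [ip]; ring

lemma ip_neg_left (x z : V7) : ip (-x) z = -ip x z := by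
  simp [ip]; ring

lemma ip_smul_left (k : ℝ) (x z : V7) : ip (k • x) z = k * ip x z := by
  simp [ip]; ring

lemma ip_zero_left (z : V7) : ip 0 z = 0 := by
  simp [ip]

lemma eq_zero_of_ip_eq_zero {x : V7} (h : ∀ y, ip x y = 0) : x = 0 := by
  ext i
  fin_cases i
  · simpa [ip, e] using h (e 4)
  · simpa [ip, e] using h (e 5)
  · simpa [ip, e] using h (e 6)
  · simpa [ip, e] using h (e 3)
  · simpa [ip, e] using h (e 0)
  · simpa [ip, e] using h (e 1)
  · simpa [ip, e] using h (e 2)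

lemma matrix_eq_zero_of_ip_eq_zero {X : M7} (h : ∀ x y, ip (X *ᵥ x) y = 0) : X = 0 := by
  apply Matrix.ext_of_mulVec_single
  intro i
  rw [Matrix.zero_mulVec]
  exact eq_zero_of_ip_eq_zero fun y => h _ y

/-- `𝔥^III` consists of matrices that are skew with respect to `ip`. -/
lemma ip_mulVec_skew {X : M7} (hX : X ∈ hIII) (x y : V7) :
    ip (X *ᵥ x) y = -ip (X *ᵥ y) x := by
  obtain ⟨A, v, w, rfl⟩ := hX
  simp [ip, h3, hmat, Matrix.mulVec, dotProduct, Fin.sum_univ_succ]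
  ring

lemma exists_eq_h3_zero {X : M7} (hX : X ∈ hIII) (hv : X *ᵥ e 3 = 0)
    (hA : ∀ u α, (u = e 1 ∨ u = e 2) → (α = e 5 ∨ α = e 6) → ip (X *ᵥ u) α = 0) :
    ∃ p q, X = h3 !![0, 0; 0, 0] 0 ![p, q] := by
  obtain ⟨a, b, c, d, v, p, q, rfl⟩ := exists_of_mem_hIII hX
  have hv' := congrFun hv 0
  have h15 := hA _ _ (.inl rfl) (.inl rfl)
  have h16 := hA _ _ (.inl rfl) (.inr rfl)
  have h25 := hA _ _ (.inr rfl) (.inl rfl)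
  have h26 := hA _ _ (.inr rfl) (.inr rfl)
  rw [h3_mulVec_e1] at h15 h16
  rw [h3_mulVec_e2] at h25 h26
  rw [h3_mulVec_e3] at hv'
  simp [ip, e] at h15 h16 h25 h26 hv'
  subst h15 h16 h25 h26 hv'
  exact ⟨p, q, rfl⟩

end Form

section Curvature

variable {bk : V7 → V7 → V7} {L : V7 →ₗ[ℝ] M7}

lemma curv_mem_hIII (hL : ∀ x, L x ∈ hIII) (x y : V7) : curv L bk x y ∈ hIII :=
  sub_mem_hIII (commutator_mem_hIII (hL x) (hL y)) (hL _)

lemma curv_skew (hbk : ∀ x y : V7, L x *ᵥ y - L y *ᵥ x = bk x y) (x y : V7) :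
    curv L bk x y = -curv L bk y x := by
  simp only [curv, ← hbk, map_sub]
  abel

lemma curv_add_left (hbk : ∀ x y : V7, L x *ᵥ y - L y *ᵥ x = bk x y) (x y z : V7) :
    curv L bk (x + y) z = curv L bk x z + curv L bk y z := by
  simp only [curv, ← hbk, map_sub, map_add, add_mul, mul_add, Matrix.add_mulVec,
    Matrix.mulVec_add]
  abel

lemma curv_smul_left (hbk : ∀ x y : V7, L x *ᵥ y - L y *ᵥ x = bk x y) (c : ℝ) (x z : V7) :
    curv L bk (c • x) z = c • curv L bk x z := by
  simp only [curv, ← hbk, map_sub, map_smul, smul_mul_assoc, mul_smul_comm, Matrix.smul_mulVec,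
    Matrix.mulVec_smul, smul_sub]

lemma curv_sub_left (hbk : ∀ x y : V7, L x *ᵥ y - L y *ᵥ x = bk x y) (x y z : V7) :
    curv L bk (x - y) z = curv L bk x z - curv L bk y z := by
  have := curv_add_left hbk (x - y) y z
  rw [sub_add_cancel] at this
  rw [this, add_sub_cancel_right]

lemma first_bianchi (hbk : ∀ x y : V7, L x *ᵥ y - L y *ᵥ x = bk x y)
    (hjac : ∀ x y z : V7, bk (bk x y) z + bk (bk y z) x + bk (bk z x) y = 0) (x y z : V7) :
    curv L bk x y *ᵥ z + curv L bk y z *ᵥ x + curv L bk z x *ᵥ y = 0 := by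
  have h := hjac x y z
  simp only [← hbk, map_sub, Matrix.sub_mulVec, Matrix.mulVec_sub, Matrix.mulVec_mulVec] at h
  simp only [curv, ← hbk, map_sub, Matrix.sub_mulVec]
  rw [← neg_eq_zero, ← h]
  abel

lemma second_bianchi (hjac : ∀ x y z : V7, bk (bk x y) z + bk (bk y z) x + bk (bk z x) y = 0)
    (x y z : V7) :
    (L x * curv L bk y z - curv L bk y z * L x) + (L y * curv L bk z x - curv L bk z x * L y) +
      (L z * curv L bk x y - curv L bk x y * L z) =
    curv L bk (bk y z) x + curv L bk (bk z x) y + curv L bk (bk x y) z := by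
  have h := congrArg L (hjac x y z)
  simp only [map_add, map_zero] at h
  rw [← sub_eq_zero, ← h]
  simp only [curv]
  noncomm_ring

lemma curv_pair_symm (hbk : ∀ x y : V7, L x *ᵥ y - L y *ᵥ x = bk x y)
    (hjac : ∀ x y z : V7, bk (bk x y) z + bk (bk y z) x + bk (bk z x) y = 0)
    (hL : ∀ x, L x ∈ hIII) (x y z w : V7) :
    ip (curv L bk x y *ᵥ z) w = ip (curv L bk z w *ᵥ x) y := by
  have b (x y z w : V7) : ip (curv L bk x y *ᵥ z) w + ip (curv L bk y z *ᵥ x) w +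
      ip (curv L bk z x *ᵥ y) w = 0 := by
    rw [← ip_add_left, ← ip_add_left, first_bianchi hbk hjac, ip_zero_left]
  have s (x y z w : V7) : ip (curv L bk x y *ᵥ z) w = -ip (curv L bk y x *ᵥ z) w := by
    rw [curv_skew hbk, Matrix.neg_mulVec, ip_neg_left]
  have t (x y z w : V7) := ip_mulVec_skew (curv_mem_hIII (bk := bk) hL x y) z w
  linarith [b x y z w, b y z w x, b z w x y, b w x y z, t x y z w, t y z x w, t z x y w,
    t y z w x, t z w y x, t w y z x, t z w x y, t w x z y, t x z w y, t w x y z, t x y w z,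
    t y w x z, s x z w y, s y w x z, s z x y w, s w y z x, s x z y w, s y w z x]

/-- Elements of `𝔥^III` see only part of `Λ²ℝ⁷`, so by pair symmetry the curvature vanishes on
the complementary pairs. -/
lemma curv_eq_zero (hbk : ∀ x y : V7, L x *ᵥ y - L y *ᵥ x = bk x y)
    (hjac : ∀ x y z : V7, bk (bk x y) z + bk (bk y z) x + bk (bk z x) y = 0)
    (hL : ∀ x, L x ∈ hIII) {x y : V7} (h : ∀ X ∈ hIII, ip (X *ᵥ x) y = 0) :
    curv L bk x y = 0 :=
  matrix_eq_zero_of_ip_eq_zero fun z w => by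
    rw [curv_pair_symm hbk hjac hL]
    exact h _ (curv_mem_hIII hL z w)

lemma curv_comm_eq_zero (hbk : ∀ x y : V7, L x *ᵥ y - L y *ᵥ x = bk x y) {x y : V7}
    (h : curv L bk x y = 0) : curv L bk y x = 0 := by
  rw [curv_skew hbk, h, neg_zero]

lemma curv_self (hbk : ∀ x y : V7, L x *ᵥ y - L y *ᵥ x = bk x y)
    (hjac : ∀ x y z : V7, bk (bk x y) z + bk (bk y z) x + bk (bk z x) y = 0)
    (hL : ∀ x, L x ∈ hIII) (x : V7) :
    curv L bk x x = 0 :=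
  curv_eq_zero hbk hjac hL fun X hX => by linarith [ip_mulVec_skew hX x x]

lemma curv_e0_or_e3_eq_zero (hbk : ∀ x y : V7, L x *ᵥ y - L y *ᵥ x = bk x y)
    (hjac : ∀ x y z : V7, bk (bk x y) z + bk (bk y z) x + bk (bk z x) y = 0)
    (hL : ∀ x, L x ∈ hIII)
    (x : V7) (hx : x = e 0 ∨ x = e 3) (y : V7)
    (hy : y = e 0 ∨ y = e 1 ∨ y = e 2 ∨ y = e 3 ∨ y = e 5 ∨ y = e 6) :
    curv L bk y x = 0 := by
  refine curv_comm_eq_zero hbk (curv_eq_zero hbk hjac hL fun X hX => ?_)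
  obtain ⟨a, b, c, d, v, p, q, rfl⟩ := exists_of_mem_hIII hX
  rcases hx with rfl | rfl <;> rcases hy with rfl | rfl | rfl | rfl | rfl | rfl <;>
    simp only [h3_mulVec_e0, h3_mulVec_e3] <;> simp [ip, e]

lemma curv_e1_e2 (hbk : ∀ x y : V7, L x *ᵥ y - L y *ᵥ x = bk x y)
    (hjac : ∀ x y z : V7, bk (bk x y) z + bk (bk y z) x + bk (bk z x) y = 0)
    (hL : ∀ x, L x ∈ hIII) :
    curv L bk (e 1) (e 2) = 0 := by
  refine curv_eq_zero hbk hjac hL fun X hX => ?_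
  obtain ⟨a, b, c, d, v, p, q, rfl⟩ := exists_of_mem_hIII hX
  rw [h3_mulVec_e1]
  simp [ip, e]

lemma curv_e0_e4 (hbk : ∀ x y : V7, L x *ᵥ y - L y *ᵥ x = bk x y)
    (hjac : ∀ x y z : V7, bk (bk x y) z + bk (bk y z) x + bk (bk z x) y = 0)
    (hL : ∀ x, L x ∈ hIII) :
    curv L bk (e 0) (e 4) = curv L bk (e 1) (e 5) + curv L bk (e 2) (e 6) := by
  have symm := curv_pair_symm hbk hjac hL
  rw [← sub_eq_zero]
  refine matrix_eq_zero_of_ip_eq_zero fun x y => ?_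
  rw [sub_eq_add_neg, neg_add, Matrix.add_mulVec, Matrix.add_mulVec, Matrix.neg_mulVec,
    Matrix.neg_mulVec, ip_add_left, ip_add_left, ip_neg_left, ip_neg_left, symm, symm (e 1),
    symm (e 2)]
  obtain ⟨a, b, c, d, v, p, q, h⟩ := exists_of_mem_hIII (curv_mem_hIII hL x y)
  rw [h, h3_mulVec_e0, h3_mulVec_e1, h3_mulVec_e2]
  simp [ip, e]
  ring

lemma curv_e3_e4 (hbk : ∀ x y : V7, L x *ᵥ y - L y *ᵥ x = bk x y)
    (hjac : ∀ x y z : V7, bk (bk x y) z + bk (bk y z) x + bk (bk z x) y = 0)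
    (hL : ∀ x, L x ∈ hIII) :
    curv L bk (e 3) (e 4) = Real.sqrt 2 • curv L bk (e 6) (e 5) := by
  have symm := curv_pair_symm hbk hjac hL
  rw [← sub_eq_zero, ← curv_smul_left hbk]
  refine matrix_eq_zero_of_ip_eq_zero fun x y => ?_
  rw [sub_eq_add_neg, Matrix.add_mulVec, Matrix.neg_mulVec, ip_add_left, ip_neg_left, symm,
    symm (_ • _)]
  obtain ⟨a, b, c, d, v, p, q, h⟩ := exists_of_mem_hIII (curv_mem_hIII hL x y)
  rw [h, Matrix.mulVec_smul, h3_mulVec_e3, h3_mulVec_e6]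
  simp [ip, e]

lemma curv_mulVec_eq_zero (hbk : ∀ x y : V7, L x *ᵥ y - L y *ᵥ x = bk x y)
    (hjac : ∀ x y z : V7, bk (bk x y) z + bk (bk y z) x + bk (bk z x) y = 0) {x y z : V7}
    (hxz : curv L bk x z = 0) (hyz : curv L bk y z = 0) : curv L bk x y *ᵥ z = 0 := by
  simpa [hyz, curv_comm_eq_zero hbk hxz] using first_bianchi hbk hjac x y z

lemma curv_e0_e4_eq_h3 (hbk : ∀ x y : V7, L x *ᵥ y - L y *ᵥ x = bk x y)
    (hjac : ∀ x y z : V7, bk (bk x y) z + bk (bk y z) x + bk (bk z x) y = 0)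
    (hL : ∀ x, L x ∈ hIII) :
    ∃ p q, curv L bk (e 0) (e 4) = h3 !![0, 0; 0, 0] 0 ![p, q] := by
  have z := curv_e0_or_e3_eq_zero hbk hjac hL
  have symm := curv_pair_symm hbk hjac hL
  have z650 : curv L bk (e 6) (e 5) *ᵥ e 0 = 0 :=
    curv_mulVec_eq_zero hbk hjac (z _ (by simp) _ (by simp)) (z _ (by simp) _ (by simp))
  refine exists_eq_h3_zero (curv_mem_hIII hL _ _) ?_ fun u α hu hα => ?_
  · have h := first_bianchi hbk hjac (e 0) (e 4) (e 3)
    rw [curv_skew hbk (e 4), curv_e3_e4 hbk hjac hL, z (e 0) (.inl rfl) (e 3) (by simp)] at h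
    simpa [Matrix.neg_mulVec, Matrix.smul_mulVec, z650] using h
  · rw [symm, curv_mulVec_eq_zero hbk hjac (z _ (.inl rfl) u (by tauto))
      (z _ (.inl rfl) α (by tauto)), ip_zero_left]

lemma curv_e6_e5_eq_h3 (hbk : ∀ x y : V7, L x *ᵥ y - L y *ᵥ x = bk x y)
    (hjac : ∀ x y z : V7, bk (bk x y) z + bk (bk y z) x + bk (bk z x) y = 0)
    (hL : ∀ x, L x ∈ hIII) :
    ∃ p q, curv L bk (e 6) (e 5) = h3 !![0, 0; 0, 0] 0 ![p, q] := by
  have z := curv_e0_or_e3_eq_zero hbk hjac hL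
  have symm := curv_pair_symm hbk hjac hL
  have hs : Real.sqrt 2 ≠ 0 := by positivity
  have z653 : curv L bk (e 6) (e 5) *ᵥ e 3 = 0 :=
    curv_mulVec_eq_zero hbk hjac (z _ (by simp) _ (by simp)) (z _ (by simp) _ (by simp))
  refine exists_eq_h3_zero (curv_mem_hIII hL _ _) z653 fun u α hu hα => ?_
  have h := symm (e 3) (e 4) u α
  rw [curv_e3_e4 hbk hjac hL, curv_mulVec_eq_zero hbk hjac (z _ (.inr rfl) u (by tauto))
      (z _ (.inr rfl) α (by tauto)), ip_zero_left, ← curv_smul_left hbk, symm,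
    Matrix.mulVec_smul] at h
  rw [symm]
  rw [ip_smul_left] at h
  exact (mul_eq_zero.1 h).resolve_left hs

end Curvature

/-- The elements `h(A,0,y)` of `𝔥^III` with `tr A = 0`. -/
def traceFreeStabilizer : Submodule ℝ M7 where
  carrier := {X | ∃ a b c p q, X = h3 !![a, b; c, -a] 0 ![p, q]}
  zero_mem' := ⟨0, 0, 0, 0, 0, by
    ext i j; fin_cases i <;> fin_cases j <;> simp [h3, hmat]⟩
  add_mem' := by
    rintro _ _ ⟨a, b, c, p, q, rfl⟩ ⟨a', b', c', p', q', rfl⟩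
    refine ⟨a + a', b + b', c + c', p + p', q + q', ?_⟩
    ext i j; fin_cases i <;> fin_cases j <;> simp [h3, hmat] <;> ring
  smul_mem' := by
    rintro k _ ⟨a, b, c, p, q, rfl⟩
    refine ⟨k * a, k * b, k * c, k * p, k * q, ?_⟩
    ext i j; fin_cases i <;> fin_cases j <;> simp [h3, hmat]

lemma mem_traceFreeStabilizer {X : M7} (hX : X ∈ hIII) (htr : ip (X *ᵥ e 0) (e 4) = 0)
    (hv : ip (X *ᵥ e 6) (e 5) = 0) : X ∈ traceFreeStabilizer := by
  obtain ⟨a, b, c, d, v, p, q, rfl⟩ := exists_of_mem_hIII hX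
  rw [h3_mulVec_e0] at htr
  rw [h3_mulVec_e6] at hv
  simp [ip, e] at htr hv
  obtain rfl : d = -a := by linarith
  subst hv
  exact ⟨a, b, c, p, q, rfl⟩

lemma commutator_mem_traceFreeStabilizer {X Y : M7} (hX : X ∈ hIII)
    (hY : Y ∈ traceFreeStabilizer) : X * Y - Y * X ∈ traceFreeStabilizer := by
  obtain ⟨a, b, c, d, v, p, q, rfl⟩ := exists_of_mem_hIII hX
  obtain ⟨a', b', c', p', q', rfl⟩ := hY
  rw [h3_commutator]
  rw [mul_zero, add_neg_cancel, zero_mul, sub_zero]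
  exact ⟨_, _, _, _, _, rfl⟩

lemma decomposable_of_le {H : Submodule ℝ M7} (hH : H ≤ traceFreeStabilizer) :
    Decomposable (H : Set M7) := by
  have he : e 3 ≠ 0 := fun h => by simpa [e] using congrFun h 3
  refine ⟨ℝ ∙ e 3, by simpa using he, fun h => ?_, fun X hX w hw => ?_, fun w hw hn => ?_⟩
  · obtain ⟨k, hk⟩ := Submodule.mem_span_singleton.1 (h ▸ Submodule.mem_top : e 0 ∈ ℝ ∙ e 3)
    simpa [e] using congrFun hk 0
  · obtain ⟨k, rfl⟩ := Submodule.mem_span_singleton.1 hw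
    obtain ⟨a, b, c, p, q, rfl⟩ := hH hX
    simp [Matrix.mulVec_smul, h3_mulVec_e3]
  · obtain ⟨k, rfl⟩ := Submodule.mem_span_singleton.1 hw
    have := hn _ (Submodule.mem_span_singleton_self _)
    simp [ip, e] at this
    simp [this]

/-- A `2 × 2` linear system with matrix `A + s` where `s` is minus a non-eigenvalue. -/
lemma eq_zero_of_shifted_system {a b c d s p q : ℝ} (hdet : (a + s) * (d + s) - b * c ≠ 0)
    (h₁ : (a + s) * p + b * q = 0) (h₂ : c * p + (d + s) * q = 0) : p = 0 ∧ q = 0 := by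
  constructor <;> apply (mul_eq_zero.1 _).resolve_left hdet
  · linear_combination (d + s) * h₁ - b * h₂
  · linear_combination (a + s) * h₂ - c * h₁

set_option maxHeartbeats 600000 in
/-- The second Bianchi identity with first argument `r = e_1` or `r = e_4` makes the `ℝ²`-components
of `R(e_1,e_5)` and `R(e_7,e_6)` eigenvectors of the `𝔤𝔩(2,ℝ)`-part `A` of `Λ(r)`, with eigenvalues
`-tr A` and `-2 tr A`; the hypotheses exclude both. -/
lemma curv_vanishing {bk : V7 → V7 → V7} {L : V7 →ₗ[ℝ] M7}
    (hbk : ∀ x y : V7, L x *ᵥ y - L y *ᵥ x = bk x y)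
    (hjac : ∀ x y z : V7, bk (bk x y) z + bk (bk y z) x + bk (bk z x) y = 0)
    (hL : ∀ x, L x ∈ hIII) (r : V7) (hr : r = e 0 ∨ r = e 3)
    (h₁ : 2 * (proA (L r)).trace ^ 2 + (proA (L r)).det ≠ 0)
    (h₂ : 6 * (proA (L r)).trace ^ 2 + (proA (L r)).det ≠ 0) :
    curv L bk (e 0) (e 4) = 0 ∧ curv L bk (e 6) (e 5) = 0 := by
  have flip {x y : V7} := curv_comm_eq_zero (x := x) (y := y) hbk
  have z := curv_e0_or_e3_eq_zero hbk hjac hL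
  have z12 := curv_e1_e2 hbk hjac hL
  have htrace := curv_e0_e4 hbk hjac hL
  obtain ⟨τ₁, τ₂, hτ⟩ := curv_e0_e4_eq_h3 hbk hjac hL
  obtain ⟨μ₁, μ₂, hμ⟩ := curv_e6_e5_eq_h3 hbk hjac hL
  obtain ⟨a, b, c, d, v, p, q, hLr⟩ := exists_of_mem_hIII (hL r)
  have hdet₁ : (a + (a + d)) * (d + (a + d)) - b * c ≠ 0 := by
    convert h₁ using 1
    simp [hLr, proA, h3, hmat, Matrix.trace, Matrix.det_fin_two]
    ring
  have hdet₂ : (a + 2 * (a + d)) * (d + 2 * (a + d)) - b * c ≠ 0 := by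
    convert h₂ using 1
    simp [hLr, proA, h3, hmat, Matrix.trace, Matrix.det_fin_two]
    ring
  have hbr (x : V7) : ∃ k : ℝ, bk x r = k • e 0 - L r *ᵥ x := by
    obtain ⟨a, b, c, d, v, p, q, hx⟩ := exists_of_mem_hIII (hL x)
    rcases hr with rfl | rfl
    · exact ⟨_, by rw [← hbk, hx, h3_mulVec_e0]⟩
    · exact ⟨_, by rw [← hbk, hx, h3_mulVec_e3]⟩
  have hbr' (x : V7) : ∃ k : ℝ, bk r x = L r *ᵥ x + k • e 0 := by
    obtain ⟨k, hk⟩ := hbr x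
    refine ⟨-k, ?_⟩
    rw [← hbk, ← neg_sub, hbk, hk]
    module
  have zr := z r hr
  have zr0 := zr _ (.inl rfl)
  have zr1 := zr (e 1) (by simp)
  have zr2 := zr (e 2) (by simp)
  have zr5 := zr (e 5) (by simp)
  have zr6 := zr (e 6) (by simp)
  have z0 (y : V7) (hy : y = e 1 ∨ y = e 2 ∨ y = e 5 ∨ y = e 6) : curv L bk (e 0) y = 0 :=
    flip (z _ (.inl rfl) y (by tauto))
  have hclosed (x y : V7) (hx : x = e 1 ∨ x = e 2 ∨ x = e 5 ∨ x = e 6)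
      (hy : y = e 1 ∨ y = e 2 ∨ y = e 5 ∨ y = e 6) : curv L bk (bk x y) r = 0 := by
    have aux (x y : V7) (hy : y = e 1 ∨ y = e 2 ∨ y = e 5 ∨ y = e 6) :
        curv L bk (L x *ᵥ y) r = 0 := by
      obtain ⟨a, b, c, d, v, p, q, hx⟩ := exists_of_mem_hIII (hL x)
      rcases hy with rfl | rfl | rfl | rfl <;>
        simp only [hx, h3_mulVec_e1, h3_mulVec_e2, h3_mulVec_e5, h3_mulVec_e6,
          curv_add_left hbk, curv_smul_left hbk, zr0, zr1, zr2, zr5, zr6, smul_zero, add_zero]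
    rw [← hbk, curv_sub_left hbk, aux x y hy, aux y x hx, sub_zero]
  have hB (x y : V7) (hx : x = e 1 ∨ x = e 2 ∨ x = e 5 ∨ x = e 6)
      (hy : y = e 1 ∨ y = e 2 ∨ y = e 5 ∨ y = e 6) :
      L r * curv L bk x y - curv L bk x y * L r =
        curv L bk (L r *ᵥ x) y - curv L bk (L r *ᵥ y) x := by
    have h := second_bianchi (L := L) hjac r x y
    obtain ⟨k, hk⟩ := hbr y
    obtain ⟨l, hl⟩ := hbr' x
    rw [hclosed x y hx hy, zr y (by tauto), flip (zr x (by tauto)), hk, hl,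
      curv_sub_left hbk, curv_add_left hbk, curv_smul_left hbk, curv_smul_left hbk, z0 x hx,
      z0 y hy] at h
    simp only [mul_zero, zero_mul, sub_zero, add_zero, smul_zero, zero_add, zero_sub] at h
    rw [h]
    abel
  have s65 := curv_skew hbk (e 5) (e 6)
  have s21 := flip z12
  have hτeq : L r * curv L bk (e 0) (e 4) - curv L bk (e 0) (e 4) * L r = 0 := by
    have h15 := hB (e 1) (e 5) (by simp) (by simp)
    have h26 := hB (e 2) (e 6) (by simp) (by simp)
    have : L r * curv L bk (e 0) (e 4) - curv L bk (e 0) (e 4) * L r =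
        (L r * curv L bk (e 1) (e 5) - curv L bk (e 1) (e 5) * L r) +
        (L r * curv L bk (e 2) (e 6) - curv L bk (e 2) (e 6) * L r) := by
      rw [htrace]; noncomm_ring
    rw [this, h15, h26]
    simp only [hLr, h3_mulVec_e1, h3_mulVec_e2, h3_mulVec_e5, h3_mulVec_e6, curv_add_left hbk,
      curv_smul_left hbk, z0 (e 1) (by simp), z0 (e 2) (by simp), z12, s21,
      curv_skew hbk (e 5) (e 1), curv_skew hbk (e 5) (e 2), curv_skew hbk (e 6) (e 1),
      curv_skew hbk (e 6) (e 2)]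
    module
  have hτ0 : τ₁ = 0 ∧ τ₂ = 0 := by
    rw [hτ, hLr, h3_commutator] at hτeq
    have e₁ := congrFun (congrFun hτeq 1) 4
    have e₂ := congrFun (congrFun hτeq 2) 4
    simp [h3, hmat] at e₁ e₂
    exact eq_zero_of_shifted_system hdet₁ (by linarith) (by linarith)
  have h04 : curv L bk (e 0) (e 4) = 0 := by
    rw [hτ, hτ0.1, hτ0.2]
    ext i j; fin_cases i <;> fin_cases j <;> simp [h3, hmat]
  have hμeq : L r * curv L bk (e 6) (e 5) - curv L bk (e 6) (e 5) * L r =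
      (-(a + d)) • curv L bk (e 6) (e 5) := by
    rw [hB (e 6) (e 5) (by simp) (by simp)]
    have h26 : curv L bk (e 2) (e 6) = -curv L bk (e 1) (e 5) := by
      rw [eq_neg_iff_add_eq_zero, add_comm, ← htrace, h04]
    simp only [hLr, h3_mulVec_e5, h3_mulVec_e6, curv_add_left hbk, curv_smul_left hbk,
      z0 (e 5) (by simp), z0 (e 6) (by simp), curv_self hbk hjac hL, h26, s65]
    module
  have hμ0 : μ₁ = 0 ∧ μ₂ = 0 := by
    rw [hμ, hLr, h3_commutator] at hμeq
    have e₁ := congrFun (congrFun hμeq 1) 4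
    have e₂ := congrFun (congrFun hμeq 2) 4
    simp [h3, hmat] at e₁ e₂
    exact eq_zero_of_shifted_system hdet₂ (by linarith) (by linarith)
  refine ⟨h04, ?_⟩
  rw [hμ, hμ0.1, hμ0.2]
  ext i j; fin_cases i <;> fin_cases j <;> simp [h3, hmat]

theorem stmt9 (bk : V7 → V7 → V7) (L : V7 →ₗ[ℝ] M7)
    (hbk : ∀ x y : V7, (L x).mulVec y - (L y).mulVec x = bk x y)
    (halt : ∀ x : V7, bk x x = 0)
    (hjac : ∀ x y z : V7, bk (bk x y) z + bk (bk y z) x + bk (bk z x) y = 0)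
    (hL : ∀ x, L x ∈ hIII)
    (h : (2 * (proA (L (e 0))).trace ^ 2 + (proA (L (e 0))).det ≠ 0 ∧
          6 * (proA (L (e 0))).trace ^ 2 + (proA (L (e 0))).det ≠ 0) ∨
         (2 * (proA (L (e 3))).trace ^ 2 + (proA (L (e 3))).det ≠ 0 ∧
          6 * (proA (L (e 3))).trace ^ 2 + (proA (L (e 3))).det ≠ 0)) :
    Decomposable (infHol L bk : Set M7) := by
  obtain ⟨h04, h65⟩ : curv L bk (e 0) (e 4) = 0 ∧ curv L bk (e 6) (e 5) = 0 := by
    rcases h with ⟨h₁, h₂⟩ | ⟨h₁, h₂⟩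
    · exact curv_vanishing hbk hjac hL _ (.inl rfl) h₁ h₂
    · exact curv_vanishing hbk hjac hL _ (.inr rfl) h₁ h₂
  refine decomposable_of_le (sInf_le ⟨fun x y => ?_, fun z X hX => ?_⟩)
  · refine mem_traceFreeStabilizer (curv_mem_hIII hL x y) ?_ ?_
    · rw [curv_pair_symm hbk hjac hL, h04, Matrix.zero_mulVec, ip_zero_left]
    · rw [curv_pair_symm hbk hjac hL, h65, Matrix.zero_mulVec, ip_zero_left]
  · exact commutator_mem_traceFreeStabilizer (hL z) hX
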